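/- arXiv:2003.06526 — 4 statements merged into one kernel-verified Lean document; each statement's English description precedes it below -/
import Mathlib

section
/- Let ψ = (ψ_i)_{i=1}^I ∈ 𝓕. Then for every i = 1, 2, …, I, the function φ_i belongs to 𝒞^↑, i.e. φ_i is continuous, satisfies φ_i(0) = 0, is strictly increasing, and φ_i(u) → ∞ as u → ∞. -/
open Set Filter

noncomputable section

/-- `f ∈ 𝒞`: continuous, non-decreasing, `ℝ₊`-valued on `ℝ₊`, with `f 0 = 0`. -/
def memC (f : ℝ → ℝ) : Prop :=
  ContinuousOn f (Ici 0) ∧ MonotoneOn f (Ici 0) ∧ f 0 = 0 ∧ ∀ u ∈ Ici (0:ℝ), 0 ≤ f u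

/-- `f ∈ 𝒞^↑`: member of `𝒞` that is strictly increasing and tends to `∞` at `∞`. -/
def memCup (f : ℝ → ℝ) : Prop :=
  memC f ∧ StrictMonoOn f (Ici 0) ∧ Tendsto f atTop atTop

/-- the soliton size associated with the index `i : Fin I`, namely `i+1`, as a real number. -/
def sz {I : ℕ} (i : Fin I) : ℝ := (i : ℕ) + 1

/-- the effective-distance (integrated slot density) function `φ_i`. -/
def phi {I : ℕ} (ψ : Fin I → ℝ → ℝ) (i : Fin I) (u : ℝ) : ℝ :=
  u - ∑ j, 2 * min (sz i) (sz j) * ψ j u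

/-- the top effective-distance function `φ_I` (note `min (I, j) = j` for `j ≤ I`). -/
def phiTop {I : ℕ} (ψ : Fin I → ℝ → ℝ) (u : ℝ) : ℝ :=
  u - ∑ j, 2 * sz j * ψ j u

/-- `ψ ∈ 𝓕`. -/
def memF {I : ℕ} (ψ : Fin I → ℝ → ℝ) : Prop :=
  (∀ i, memC (ψ i)) ∧ memCup (phiTop ψ)

/-- the inverse of `f : ℝ₊ → ℝ₊` (as a function `ℝ → ℝ` supported in domain `Ici 0`). -/
def rinv (f : ℝ → ℝ) : ℝ → ℝ := Function.invFunOn f (Ici 0)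

/-- the effective scaling (scattering) map `Υ`. -/
def Upsilon {I : ℕ} (ψ : Fin I → ℝ → ℝ) : Fin I → ℝ → ℝ :=
  fun i => ψ i ∘ rinv (phi ψ i)

/-- `gammaK ψb k = γ_{I-k}`, defined by downward recursion from `γ_I = id`:
`γ_i(z) = z + ∑_{j>i} 2(j-i) ψb_j (γ_j z)`. -/
def gammaK {I : ℕ} (ψb : Fin I → ℝ → ℝ) : ℕ → ℝ → ℝ
  | 0 => fun z => z
  | k + 1 => fun z =>
      z + ∑ m ∈ (Finset.range (k + 1)).attach,
        2 * (((k + 1 : ℕ) : ℝ) - ((m : ℕ) : ℝ)) *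
          (if h : (m : ℕ) < I then
              ψb ⟨I - 1 - (m : ℕ), by omega⟩ (gammaK ψb (m : ℕ) z)
            else 0)
  termination_by k => k
  decreasing_by have hm := Finset.mem_range.mp m.2; omega

/-- `γ_i`, for `i = 0, 1, …, I`. -/
def gam {I : ℕ} (ψb : Fin I → ℝ → ℝ) (i : ℕ) : ℝ → ℝ := gammaK ψb (I - i)

/-- the spatial reconstruction (inverse scattering) map `Γ`. -/
def Gamma {I : ℕ} (ψb : Fin I → ℝ → ℝ) : Fin I → ℝ → ℝ :=
  fun i => ψb i ∘ gam ψb ((i : ℕ) + 1) ∘ rinv (gam ψb 0)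

/-- the free-evolution shift `θ_t`. -/
def theta {I : ℕ} (t : ℝ) (ψb : Fin I → ℝ → ℝ) : Fin I → ℝ → ℝ :=
  fun i z => ψb i (max (z - sz i * t) 0)

/-- `ψ ∈ 𝒟`: member of `𝓕` satisfying the density condition
`∑_i i · sup_{u₁≠u₂} (ψ_i(u₁)-ψ_i(u₂))/(φ_i(u₁)-φ_i(u₂)) < 1/2`. -/
def memD {I : ℕ} (ψ : Fin I → ℝ → ℝ) : Prop :=
  memF ψ ∧
  ∃ c : Fin I → ℝ,
    (∀ i, ∀ u₁ ∈ Ici (0:ℝ), ∀ u₂ ∈ Ici (0:ℝ), u₂ < u₁ →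
      ψ i u₁ - ψ i u₂ ≤ c i * (phi ψ i u₁ - phi ψ i u₂)) ∧
    ∑ i, sz i * c i < 1 / 2

/-- `ψb ∈ 𝒟̄`: member of `𝒞^I` satisfying the density condition
`∑_i i · sup_{z₁≠z₂} (ψb_i(z₁)-ψb_i(z₂))/(z₁-z₂) < 1/2`. -/
def memDbar {I : ℕ} (ψb : Fin I → ℝ → ℝ) : Prop :=
  (∀ i, memC (ψb i)) ∧
  ∃ c : Fin I → ℝ,
    (∀ i, ∀ z₁ ∈ Ici (0:ℝ), ∀ z₂ ∈ Ici (0:ℝ), z₂ < z₁ →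
      ψb i z₁ - ψb i z₂ ≤ c i * (z₁ - z₂)) ∧
    ∑ i, sz i * c i < 1 / 2

/-- the extension `f^ℝ` of `f` to `ℝ`, by `0` on the negative half-line. -/
def extZ (f : ℝ → ℝ) : ℝ → ℝ := fun u => if 0 ≤ u then f u else 0

/-- the extension `f^{ℝ,↑}` of `f` to `ℝ`, by the identity on the negative half-line. -/
def extId (f : ℝ → ℝ) : ℝ → ℝ := fun u => if 0 ≤ u then f u else u

/-- `f ∈ 𝒞^q`. -/
def memCq (q : ℕ) (f : ℝ → ℝ) : Prop := memC f ∧ ContDiff ℝ q (extZ f)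

/-- `f ∈ 𝒞^{↑,q}`. -/
def memCupq (q : ℕ) (f : ℝ → ℝ) : Prop := memCup f ∧ ContDiff ℝ q (extId f)

/-- `f ∈ C^q(ℝ₊², ℝ₊)`: `ℝ₊`-valued and `q`-times continuously differentiable on the
quadrant (one-sided at the boundary). -/
def memCqTwo (q : ℕ) (f : ℝ → ℝ → ℝ) : Prop :=
  (∀ u ∈ Ici (0:ℝ), ∀ t ∈ Ici (0:ℝ), 0 ≤ f u t) ∧
  ContDiffOn ℝ q (fun p : ℝ × ℝ => f p.1 p.2) (Ici 0 ×ˢ Ici 0)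

/-- the matrix `M(ρ)`. -/
def Mmat {I : ℕ} (ρ : Fin I → ℝ) : Matrix (Fin I) (Fin I) ℝ :=
  Matrix.of fun i j =>
    if i = j then 1 - ∑ k ∈ Finset.univ.erase i, 2 * min (sz i) (sz k) * ρ k
    else 2 * min (sz i) (sz j) * ρ j

/-- the effective speeds `v^eff(ρ) = M(ρ)⁻¹ v`, where `v_i = i`. -/
def veff {I : ℕ} (ρ : Fin I → ℝ) : Fin I → ℝ :=
  ((Mmat ρ)⁻¹).mulVec fun i => sz i

/-- `ρ ∈ 𝒟_density`. -/
def memDdensity {I : ℕ} (ρ : Fin I → ℝ → ℝ) : Prop :=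
  (∀ i, (∀ u ∈ Ici (0:ℝ), 0 ≤ ρ i u) ∧ ContDiff ℝ 1 (extZ (ρ i))) ∧
  (∀ u ∈ Ici (0:ℝ), ∑ i, 2 * sz i * ρ i u < 1) ∧
  ∃ c : Fin I → ℝ,
    (∀ i, ∀ u ∈ Ici (0:ℝ),
      ρ i u ≤ c i * (1 - ∑ j, 2 * min (sz i) (sz j) * ρ j u)) ∧
    ∑ i, sz i * c i < 1 / 2

theorem memCup.add_memC {f g : ℝ → ℝ} (hf : memCup f) (hg : memC g) :
    memCup (fun u => f u + g u) := by
  obtain ⟨⟨hfc, hfm, hf0, hfn⟩, hfs, hft⟩ := hf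
  obtain ⟨hgc, hgm, hg0, hgn⟩ := hg
  refine ⟨⟨hfc.add hgc, hfm.add hgm, by simp [hf0, hg0],
    fun u hu => add_nonneg (hfn u hu) (hgn u hu)⟩, hfs.add_monotone hgm, ?_⟩
  refine tendsto_atTop_mono' atTop ?_ hft
  filter_upwards [eventually_ge_atTop 0] with u hu
  exact le_add_of_nonneg_right (hgn u hu)

theorem memC_sum_mul {ι : Type*} [Fintype ι] {c : ι → ℝ} {f : ι → ℝ → ℝ}
    (hc : ∀ j, 0 ≤ c j) (hf : ∀ j, memC (f j)) : memC (fun u => ∑ j, c j * f j u) := by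
  refine ⟨continuousOn_finsetSum _ fun j _ => continuousOn_const.mul (hf j).1, ?_, ?_, ?_⟩
  · intro u hu v hv huv
    exact Finset.sum_le_sum fun j _ =>
      mul_le_mul_of_nonneg_left ((hf j).2.1 hu hv huv) (hc j)
  · exact Finset.sum_eq_zero fun j _ => by rw [(hf j).2.2.1, mul_zero]
  · exact fun u hu => Finset.sum_nonneg fun j _ => mul_nonneg (hc j) ((hf j).2.2.2 u hu)

theorem phi_eq_phiTop_add {I : ℕ} (ψ : Fin I → ℝ → ℝ) (i : Fin I) :
    phi ψ i = fun u => phiTop ψ u + ∑ j, 2 * (sz j - min (sz i) (sz j)) * ψ j u := by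
  funext u
  simp only [phi, phiTop, mul_sub, sub_mul, Finset.sum_sub_distrib]
  ring

/-- for `ψ ∈ 𝓕`, each `φ_i` belongs to `𝒞^↑`. -/
theorem stmt_0 {I : ℕ} (hI : 1 ≤ I) (ψ : Fin I → ℝ → ℝ) (hψ : memF ψ) (i : Fin I) :
    memCup (phi ψ i) := by
  rw [phi_eq_phiTop_add]
  exact hψ.2.add_memC (memC_sum_mul
    (fun j => mul_nonneg zero_le_two (sub_nonneg.2 (min_le_right _ _))) hψ.1)
end
end

section
/- For every ψ̄ ∈ 𝒞^I, the spatial reconstruction Γ(ψ̄) belongs to 𝓕; that is, each component ψ̄_i ∘ γ_i ∘ γ_0^{-1} lies in 𝒞, and the function φ̃_I(u) := u − ∑_{j=1}^I 2j (Γ(ψ̄))_j(u) lies in 𝒞^↑. -/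
open Set Filter

noncomputable section

theorem memC.comp {f g : ℝ → ℝ} (hf : memC f) (hg : memC g) : memC (f ∘ g) := by
  obtain ⟨fc, fm, f0, fp⟩ := hf
  obtain ⟨gc, gm, g0, gp⟩ := hg
  exact ⟨fc.comp gc gp, fm.comp gm gp, by simp [g0, f0], fun u hu => fp _ (gp u hu)⟩

theorem memC.congr {f g : ℝ → ℝ} (hf : memC f) (h : EqOn g f (Ici 0)) : memC g :=
  ⟨hf.1.congr h, hf.2.1.congr h.symm, (h self_mem_Ici).trans hf.2.2.1,
    fun u hu => (hf.2.2.2 u hu).trans_eq (h hu).symm⟩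

theorem memC.const_mul {f : ℝ → ℝ} (hf : memC f) {c : ℝ} (hc : 0 ≤ c) :
    memC fun z => c * f z :=
  ⟨continuousOn_const.mul hf.1,
    fun _ ha _ hb hab => mul_le_mul_of_nonneg_left (hf.2.1 ha hb hab) hc,
    by simp [hf.2.2.1], fun u hu => mul_nonneg hc (hf.2.2.2 u hu)⟩

theorem memC_zero : memC fun _ => 0 :=
  ⟨continuousOn_const, monotoneOn_const, rfl, fun _ _ => le_rfl⟩

theorem memC_sum {ι : Type*} {s : Finset ι} {f : ι → ℝ → ℝ} (hf : ∀ i ∈ s, memC (f i)) :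
    memC fun z => ∑ i ∈ s, f i z :=
  ⟨continuousOn_finsetSum s fun i hi => (hf i hi).1,
    fun _ ha _ hb hab => Finset.sum_le_sum fun i hi => (hf i hi).2.1 ha hb hab,
    Finset.sum_eq_zero fun i hi => (hf i hi).2.2.1,
    fun u hu => Finset.sum_nonneg fun i hi => (hf i hi).2.2.2 u hu⟩

theorem memCup.congr {f g : ℝ → ℝ} (hf : memCup f) (h : EqOn g f (Ici 0)) : memCup g :=
  ⟨hf.1.congr h, hf.2.1.congr h.symm,
    hf.2.2.congr' ((eventually_ge_atTop 0).mono fun _ hu => (h hu).symm)⟩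

theorem memC.memCup_id_add {f : ℝ → ℝ} (hf : memC f) : memCup fun z => z + f z := by
  obtain ⟨fc, fm, f0, fp⟩ := hf
  refine ⟨⟨continuousOn_id.add fc, fun a ha b hb hab => add_le_add hab (fm ha hb hab),
    by simp [f0], fun u hu => add_nonneg hu (fp u hu)⟩,
    fun a ha b hb hab => add_lt_add_of_lt_of_le hab (fm ha hb hab.le), ?_⟩
  exact tendsto_atTop_mono' _ ((eventually_ge_atTop 0).mono fun u hu =>
    le_add_of_nonneg_right (fp u hu)) tendsto_id

theorem memCup.surjOn {f : ℝ → ℝ} (hf : memCup f) : SurjOn f (Ici 0) (Ici 0) := by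
  intro y hy
  obtain ⟨b, hby, hb⟩ := ((hf.2.2.eventually_ge_atTop y).and (eventually_ge_atTop 0)).exists
  obtain ⟨x, hx, hxy⟩ := intermediate_value_Icc hb (hf.1.1.mono Icc_subset_Ici_self)
    (⟨hf.1.2.2.1.trans_le hy, hby⟩ : y ∈ Icc (f 0) (f b))
  exact ⟨x, hx.1, hxy⟩

theorem memCup.invOn_rinv {f : ℝ → ℝ} (hf : memCup f) : InvOn (rinv f) f (Ici 0) (Ici 0) :=
  ⟨hf.2.1.injOn.leftInvOn_invFunOn, hf.surjOn.rightInvOn_invFunOn⟩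

theorem memCup.memCup_rinv {f : ℝ → ℝ} (hf : memCup f) : memCup (rinv f) := by
  obtain ⟨hl, hr⟩ := hf.invOn_rinv
  have maps : MapsTo (rinv f) (Ici 0) (Ici 0) := hf.surjOn.mapsTo_invFunOn
  have fmaps : MapsTo f (Ici 0) (Ici 0) := hf.1.2.2.2
  have strict : StrictMonoOn (rinv f) (Ici 0) := fun a ha b hb hab => by
    rwa [← hf.2.1.lt_iff_lt (maps ha) (maps hb), hr ha, hr hb]
  refine ⟨⟨?_, strict.monotoneOn, ?_, maps⟩, strict, ?_⟩
  · have hmono : Monotone (maps.restrict (rinv f) (Ici 0) (Ici 0)) := fun a b hab =>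
      strict.monotoneOn a.2 b.2 hab
    have hsurj : Function.Surjective (maps.restrict (rinv f) (Ici 0) (Ici 0)) := fun x =>
      ⟨⟨f x, fmaps x.2⟩, Subtype.ext (hl x.2)⟩
    exact continuousOn_iff_continuous_domRestrict.2
      (continuous_subtype_val.comp (hmono.continuous_of_surjective hsurj))
  · simpa [hf.1.2.2.1] using hl (self_mem_Ici : (0 : ℝ) ∈ Ici 0)
  · refine tendsto_atTop.2 fun b => ?_
    filter_upwards [eventually_ge_atTop (f (max b 0))] with u hu
    have hb : max b 0 ∈ Ici (0 : ℝ) := le_max_right b 0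
    calc b ≤ max b 0 := le_max_left b 0
      _ = rinv f (f (max b 0)) := (hl hb).symm
      _ ≤ rinv f u := strict.monotoneOn (fmaps hb) ((fmaps hb).trans hu) hu

theorem memCup_gammaK {I : ℕ} {ψb : Fin I → ℝ → ℝ} (hψb : ∀ i, memC (ψb i)) (k : ℕ) :
    memCup (gammaK ψb k) := by
  induction k using Nat.strong_induction_on with
  | _ k ih =>
    cases k with
    | zero =>
      simpa [gammaK] using memC_zero.memCup_id_add
    | succ k =>
      rw [gammaK]
      refine (memC_sum fun m _ => ?_).memCup_id_add
      have hm : (m : ℕ) < k + 1 := Finset.mem_range.1 m.2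
      have hm' : ((m : ℕ) : ℝ) < ((k + 1 : ℕ) : ℝ) := Nat.cast_lt.2 hm
      refine memC.const_mul ?_ (by linarith)
      split_ifs with h
      · exact (hψb _).comp (ih m hm).1
      · exact memC_zero

theorem gam_zero_eq {I : ℕ} (ψb : Fin I → ℝ → ℝ) (z : ℝ) :
    gam ψb 0 z = z + ∑ j : Fin I, 2 * sz j * ψb j (gam ψb ((j : ℕ) + 1) z) := by
  cases I with
  | zero => simp [gam, gammaK]
  | succ n =>
    rw [gam, Nat.sub_zero, gammaK, ← Equiv.sum_comp Fin.revPerm]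
    beta_reduce
    congr 1
    rw [Finset.sum_attach (Finset.range (n + 1)) fun m => 2 * (((n + 1 : ℕ) : ℝ) - (m : ℝ)) *
      (if h : m < n + 1 then ψb ⟨n + 1 - 1 - m, by omega⟩ (gammaK ψb m z) else 0),
      Finset.sum_range]
    refine Finset.sum_congr rfl fun j _ => ?_
    have hj : (j : ℕ) ≤ n := Nat.lt_succ_iff.1 j.2
    have hrev : (⟨n + 1 - 1 - (j : ℕ), by omega⟩ : Fin (n + 1)) = Fin.rev j :=
      Fin.ext (by simp [Fin.val_rev])
    have hidx : n + 1 - ((Fin.rev j : ℕ) + 1) = j := by rw [Fin.val_rev]; omega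
    have hsz : sz (Fin.rev j) = ((n + 1 : ℕ) : ℝ) - ((j : ℕ) : ℝ) := by
      rw [sz, Fin.val_rev, Nat.add_sub_add_right, Nat.cast_sub hj]
      push_cast
      ring
    rw [dif_pos j.2, hrev, Fin.revPerm_apply, gam, hidx, hsz]

theorem phiTop_Gamma_eqOn {I : ℕ} {ψb : Fin I → ℝ → ℝ} (hψb : ∀ i, memC (ψb i)) :
    EqOn (phiTop (Gamma ψb)) (rinv (gam ψb 0)) (Ici 0) := by
  intro u hu
  have h : gam ψb 0 (rinv (gam ψb 0) u) = u := (memCup_gammaK hψb (I - 0)).invOn_rinv.2 hu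
  rw [gam_zero_eq] at h
  simp only [phiTop, Gamma, Function.comp_apply]
  linarith

/-- for `ψb ∈ 𝒞^I`, the spatial reconstruction `Γ(ψb)` belongs to `𝓕`,
i.e. each component lies in `𝒞` and `φ̃_I(u) = u - ∑_j 2j (Γψb)_j(u)` lies in `𝒞^↑`. -/
theorem stmt_3 {I : ℕ} (hI : 1 ≤ I) (ψb : Fin I → ℝ → ℝ) (hψb : ∀ i, memC (ψb i)) :
    (∀ i, memC (Gamma ψb i)) ∧ memCup (phiTop (Gamma ψb)) := by
  have h0 : memCup (rinv (gam ψb 0)) := (memCup_gammaK hψb _).memCup_rinv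
  exact ⟨fun i => (hψb i).comp ((memCup_gammaK hψb _).1.comp h0.1),
    h0.congr (phiTop_Gamma_eqOn hψb)⟩
end
end

section
/- Fix an integer I ≥ 1. For every ρ = (ρ_1, …, ρ_I) ∈ [0,1]^I satisfying ∑_{i=1}^I 2i ρ_i < 1, the I × I real matrix M(ρ) is invertible; in fact its determinant is strictly positive. -/
open Set Filter

noncomputable section

/-- The lower triangular matrix of ones, a square root of the kernel `min (sz i) (sz j)`. -/
def lowerOnes (I : ℕ) : Matrix (Fin I) (Fin I) ℝ :=
  Matrix.of fun i k => if k ≤ i then 1 else 0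

lemma lowerOnes_mul_transpose_apply {I : ℕ} (i j : Fin I) :
    (lowerOnes I * (lowerOnes I).transpose) i j = min (sz i) (sz j) := by
  have hcard : ((Finset.univ.filter fun k : Fin I => k ≤ i ∧ k ≤ j).card : ℝ)
      = (min i j : Fin I) + 1 := by
    have h : (Finset.univ.filter fun k : Fin I => k ≤ i ∧ k ≤ j) = Finset.Iic (min i j) := by
      ext k
      simp
    rw [h, Fin.card_Iic]
    push_cast
    rfl
  have hmin : min (sz i) (sz j) = (min i j : Fin I) + 1 := by
    rcases le_total i j with h | h
    · rw [min_eq_left h, min_eq_left]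
      · rfl
      · simpa [sz] using h
    · rw [min_eq_right h, min_eq_right]
      · rfl
      · simpa [sz] using h
  rw [hmin, ← hcard]
  simp [Matrix.mul_apply, lowerOnes, ← ite_and, and_comm]

lemma Mmat_eq_diagonal_add {I : ℕ} (ρ : Fin I → ℝ) :
    Mmat ρ = Matrix.diagonal (fun i => 1 - ∑ k, 2 * min (sz i) (sz k) * ρ k)
      + lowerOnes I * (lowerOnes I).transpose * Matrix.diagonal (fun i => 2 * ρ i) := by
  ext i j
  rw [Matrix.add_apply, Matrix.mul_diagonal, lowerOnes_mul_transpose_apply]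
  by_cases hij : i = j
  · subst hij
    have h := Finset.add_sum_erase Finset.univ (fun k => 2 * min (sz i) (sz k) * ρ k)
      (Finset.mem_univ i)
    simp only [Mmat, Matrix.of_apply, if_true, Matrix.diagonal_apply_eq]
    linarith
  · simp only [Mmat, Matrix.of_apply, hij, if_false, Matrix.diagonal_apply_ne _ hij]
    ring

/-- A positive diagonal plus `B Bᵀ` times a nonnegative diagonal has positive determinant. -/
lemma det_diagonal_add_mul_transpose_mul_diagonal_pos {n : Type*} [Fintype n] [DecidableEq n]
    (B : Matrix n n ℝ) {d r : n → ℝ} (hd : ∀ i, 0 < d i) (hr : ∀ i, 0 ≤ r i) :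
    0 < (Matrix.diagonal d + B * B.transpose * Matrix.diagonal r).det := by
  have hfactor : Matrix.diagonal d + B * B.transpose * Matrix.diagonal r
      = (1 + B * (B.transpose * Matrix.diagonal (fun i => r i / d i))) * Matrix.diagonal d := by
    rw [add_mul, one_mul, Matrix.mul_assoc, Matrix.mul_assoc, Matrix.mul_assoc,
      Matrix.diagonal_mul_diagonal]
    simp only [div_mul_cancel₀ _ (hd _).ne']
  rw [hfactor, Matrix.det_mul, Matrix.det_one_add_mul_comm, Matrix.det_diagonal]
  have hpsd : (B.transpose * Matrix.diagonal (fun i => r i / d i) * B).PosSemidef := by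
    have hdiag : (Matrix.diagonal fun i => r i / d i).PosSemidef :=
      Matrix.PosSemidef.diagonal fun i => div_nonneg (hr i) (hd i).le
    simpa using hdiag.conjTranspose_mul_mul_same B
  exact mul_pos (Matrix.PosDef.one.add_posSemidef hpsd).det_pos
    (Finset.prod_pos fun i _ => hd i)

/-- for `ρ ∈ [0,1]^I` with `∑_i 2i ρ_i < 1`, the matrix `M(ρ)` is
invertible; in fact its determinant is strictly positive. -/
theorem stmt_9 {I : ℕ} (hI : 1 ≤ I) (ρ : Fin I → ℝ)
    (hρ : ∀ i, ρ i ∈ Icc (0:ℝ) 1) (hsum : ∑ i, 2 * sz i * ρ i < 1) :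
    IsUnit (Mmat ρ) ∧ 0 < (Mmat ρ).det := by
  have hdet : 0 < (Mmat ρ).det := by
    rw [Mmat_eq_diagonal_add]
    refine det_diagonal_add_mul_transpose_mul_diagonal_pos _ (fun i => ?_)
      fun i => mul_nonneg zero_le_two (hρ i).1
    have hle : ∑ k, 2 * min (sz i) (sz k) * ρ k ≤ ∑ k, 2 * sz k * ρ k := by
      gcongr with k
      · exact (hρ k).1
      · exact min_le_right _ _
    linarith
  exact ⟨(Matrix.isUnit_iff_isUnit_det _).2 hdet.ne'.isUnit, hdet⟩
end
end

section
/- Let ρ = (ρ_i)_{i=1}^I be a collection of continuous functions ρ_i : ℝ₊ → ℝ₊, and define ψ_i(u) := ∫_0^u ρ_i(u') du'. Then ρ ∈ 𝒟_density if and only if ψ = (ψ_i)_{i=1}^I ∈ 𝒟². -/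
open Set Filter

noncomputable section

theorem sz_pos {I : ℕ} (i : Fin I) : 0 < sz i := by
  unfold sz; positivity

/-- A primitive on `ℝ₊` of a function continuous on `ℝ₊` has the expected one-sided derivative. -/
theorem hasDerivWithinAt_Ici_of_eq_integral {f F : ℝ → ℝ} (hf : ContinuousOn f (Ici 0))
    (hF : ∀ u ∈ Ici (0 : ℝ), F u = ∫ x in (0 : ℝ)..u, f x) {u : ℝ} (hu : 0 ≤ u) :
    HasDerivWithinAt F (f u) (Ici 0) u := by
  have hc : Continuous fun x => f (max x 0) :=
    hf.comp_continuous (by fun_prop) fun x => le_max_right x 0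
  have hd := (hc.integral_hasStrictDerivAt 0 u).hasDerivAt.hasDerivWithinAt (s := Ici 0)
  simp only [max_eq_left hu] at hd
  have key : ∀ v ∈ Ici (0 : ℝ), F v = ∫ x in (0 : ℝ)..v, f (max x 0) := fun v hv => by
    rw [hF v hv]
    refine intervalIntegral.integral_congr fun x hx => ?_
    rw [uIcc_of_le hv] at hx
    simp only [max_eq_left hx.1]
  exact hd.congr key (key u hu)

theorem hasDerivWithinAt_sub_sum {I : ℕ} {ρ ψ : Fin I → ℝ → ℝ} {s : Set ℝ} {u : ℝ}
    (hd : ∀ i, HasDerivWithinAt (ψ i) (ρ i u) s u) (a : Fin I → ℝ) :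
    HasDerivWithinAt (fun v => v - ∑ j, a j * ψ j v) (1 - ∑ j, a j * ρ j u) s u :=
  (hasDerivWithinAt_id u s).sub (HasDerivWithinAt.fun_sum fun j _ => (hd j).const_mul (a j))

/-- Nonnegative derivative on `ℝ₊` (one-sided at `0`) implies monotonicity on `ℝ₊`. -/
theorem monotoneOn_Ici_of_hasDerivWithinAt {g g' : ℝ → ℝ}
    (hg : ∀ u ∈ Ici (0 : ℝ), HasDerivWithinAt g (g' u) (Ici 0) u)
    (hg' : ∀ u ∈ Ici (0 : ℝ), 0 ≤ g' u) : MonotoneOn g (Ici 0) :=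
  monotoneOn_of_hasDerivWithinAt_nonneg (convex_Ici 0)
    (fun u hu => (hg u hu).continuousWithinAt)
    (fun u hu => (hg u (interior_subset hu)).mono interior_subset)
    (fun u hu => hg' u (interior_subset hu))

theorem extZ_eqOn_Ici (f : ℝ → ℝ) : EqOn (extZ f) f (Ici 0) := fun _ hu => if_pos hu

theorem extZ_of_neg (f : ℝ → ℝ) {u : ℝ} (hu : u < 0) : extZ f u = 0 := if_neg hu.not_ge

theorem hasDerivAt_extZ_of_neg (f : ℝ → ℝ) {u : ℝ} (hu : u < 0) : HasDerivAt (extZ f) 0 u :=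
  (hasDerivAt_const u (0 : ℝ)).congr_of_eventuallyEq <| by
    filter_upwards [Iio_mem_nhds hu] with v hv using extZ_of_neg f hv

theorem eq_zero_of_continuous_extZ {f : ℝ → ℝ} (hf : Continuous (extZ f)) : f 0 = 0 := by
  have h1 : Tendsto (extZ f) (nhdsWithin 0 (Iio 0)) (nhds (extZ f 0)) :=
    hf.continuousAt.tendsto.mono_left nhdsWithin_le_nhds
  have h2 : Tendsto (extZ f) (nhdsWithin 0 (Iio 0)) (nhds 0) := by
    refine tendsto_const_nhds.congr' ?_
    filter_upwards [self_mem_nhdsWithin] with v hv using (extZ_of_neg f hv).symm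
  rw [← extZ_eqOn_Ici f self_mem_Ici]
  exact tendsto_nhds_unique h1 h2

theorem hasDerivAt_extZ {f F : ℝ → ℝ} (hF0 : F 0 = 0) (hf0 : f 0 = 0)
    (hF : ∀ u ∈ Ici (0 : ℝ), HasDerivWithinAt F (f u) (Ici 0) u) (u : ℝ) :
    HasDerivAt (extZ F) (extZ f u) u := by
  rcases lt_or_ge u 0 with hu | hu
  · rw [extZ_of_neg f hu]
    exact hasDerivAt_extZ_of_neg F hu
  have hr : HasDerivWithinAt (extZ F) (extZ f u) (Ici 0) u := by
    rw [extZ_eqOn_Ici f hu]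
    exact (hF u hu).congr (extZ_eqOn_Ici F) (extZ_eqOn_Ici F hu)
  rcases hu.eq_or_lt with rfl | hu
  · have hl : HasDerivWithinAt (extZ F) (extZ f 0) (Iic 0) 0 := by
      have hz : ∀ v ∈ Iic (0 : ℝ), extZ F v = 0 := fun v hv => by
        rcases (mem_Iic.1 hv).eq_or_lt with rfl | hv
        · rw [extZ_eqOn_Ici F self_mem_Ici, hF0]
        · exact extZ_of_neg F hv
      rw [extZ_eqOn_Ici f self_mem_Ici, hf0]
      exact (hasDerivWithinAt_const 0 _ (0 : ℝ)).congr hz (hz 0 self_mem_Iic)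
    have h := hl.union hr
    rwa [Iic_union_Ici, hasDerivWithinAt_univ] at h
  · exact hr.hasDerivAt (Ici_mem_nhds hu)

/-- The extension by zero of a primitive is `C²` exactly when that of its derivative is `C¹`. -/
theorem contDiff_two_extZ_iff {f F : ℝ → ℝ} (hF0 : F 0 = 0)
    (hF : ∀ u ∈ Ici (0 : ℝ), HasDerivWithinAt F (f u) (Ici 0) u) :
    ContDiff ℝ 2 (extZ F) ↔ ContDiff ℝ 1 (extZ f) := by
  rw [show (2 : WithTop ℕ∞) = 1 + 1 from one_add_one_eq_two.symm, contDiff_succ_iff_deriv]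
  constructor
  · rintro ⟨hd, -, hc⟩
    suffices h : extZ f = deriv (extZ F) from h ▸ hc
    funext u
    rcases lt_or_ge u 0 with hu | hu
    · rw [extZ_of_neg f hu, (hasDerivAt_extZ_of_neg F hu).deriv]
    · have h := (hd u).hasDerivAt.hasDerivWithinAt (s := Ici 0)
      have h' := (hF u hu).congr (extZ_eqOn_Ici F) (extZ_eqOn_Ici F hu)
      rw [extZ_eqOn_Ici f hu, (uniqueDiffOn_Ici (0 : ℝ) u hu).eq_deriv _ h h']
  · intro hc
    have h := hasDerivAt_extZ hF0 (eq_zero_of_continuous_extZ hc.continuous) hF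
    refine ⟨fun u => (h u).differentiableAt, by simp, ?_⟩
    rwa [show deriv (extZ F) = extZ f from funext fun u => (h u).deriv]

/-- The density condition bounds the total occupied length by `∑ 2 i c_i`. -/
theorem sum_two_sz_mul_le {I : ℕ} {r c : Fin I → ℝ} (hr : ∀ i, 0 ≤ r i) (hc : ∀ i, 0 ≤ c i)
    (h : ∀ i, r i ≤ c i * (1 - ∑ j, 2 * min (sz i) (sz j) * r j)) :
    ∑ i, 2 * sz i * r i ≤ 2 * ∑ i, sz i * c i := by
  rw [Finset.mul_sum]
  refine Finset.sum_le_sum fun i _ => ?_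
  have hle : 1 - ∑ j, 2 * min (sz i) (sz j) * r j ≤ 1 :=
    sub_le_self _ <| Finset.sum_nonneg fun j _ =>
      mul_nonneg (mul_nonneg zero_le_two (le_min (sz_pos i).le (sz_pos j).le)) (hr j)
  have h1 : r i ≤ c i := (h i).trans (mul_le_of_le_one_right (hc i) hle)
  rw [mul_assoc]
  exact mul_le_mul_of_nonneg_left (mul_le_mul_of_nonneg_left h1 (sz_pos i).le) zero_le_two

theorem sum_min_sz_mul_le {I : ℕ} {r : Fin I → ℝ} (hr : ∀ i, 0 ≤ r i) (i : Fin I) :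
    ∑ j, 2 * min (sz i) (sz j) * r j ≤ ∑ j, 2 * sz j * r j :=
  Finset.sum_le_sum fun j _ => mul_le_mul_of_nonneg_right
    (mul_le_mul_of_nonneg_left (min_le_right _ _) zero_le_two) (hr j)

/-- for continuous `ρ_i : ℝ₊ → ℝ₊` and `ψ_i(u) := ∫_0^u ρ_i(u')du'`,
one has `ρ ∈ 𝒟_density` if and only if `ψ ∈ 𝒟²`. -/
theorem stmt_14 {I : ℕ} (hI : 1 ≤ I) (ρ : Fin I → ℝ → ℝ)
    (hcont : ∀ i, ContinuousOn (ρ i) (Ici 0))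
    (hnn : ∀ i, ∀ u ∈ Ici (0:ℝ), 0 ≤ ρ i u)
    (ψ : Fin I → ℝ → ℝ)
    (hψ : ∀ i, ∀ u ∈ Ici (0:ℝ), ψ i u = ∫ x in (0:ℝ)..u, ρ i x) :
    memDdensity ρ ↔ (memD ψ ∧ ∀ i, memCq 2 (ψ i)) := by
  have hd : ∀ i, ∀ u ∈ Ici (0 : ℝ), HasDerivWithinAt (ψ i) (ρ i u) (Ici 0) u :=
    fun i u hu => hasDerivWithinAt_Ici_of_eq_integral (hcont i) (hψ i) hu
  have hψ0 : ∀ i, ψ i 0 = 0 := fun i => by simp [hψ i 0 self_mem_Ici]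
  have hmono : ∀ i, MonotoneOn (ψ i) (Ici 0) := fun i =>
    monotoneOn_Ici_of_hasDerivWithinAt (hd i) (hnn i)
  have hC : ∀ i, memC (ψ i) := fun i =>
    ⟨fun u hu => (hd i u hu).continuousWithinAt, hmono i, hψ0 i, fun u hu =>
      (hψ0 i).ge.trans (hmono i self_mem_Ici hu hu)⟩
  have hreg := fun i => contDiff_two_extZ_iff (hψ0 i) (hd i)
  have hphi : ∀ i, ∀ u ∈ Ici (0 : ℝ), HasDerivWithinAt (phi ψ i)
      (1 - ∑ j, 2 * min (sz i) (sz j) * ρ j u) (Ici 0) u := fun i u hu =>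
    hasDerivWithinAt_sub_sum (fun j => hd j u hu) _
  have hgap : ∀ (c : Fin I → ℝ), ∀ i, ∀ u ∈ Ici (0 : ℝ),
      HasDerivWithinAt (fun v => c i * phi ψ i v - ψ i v)
        (c i * (1 - ∑ j, 2 * min (sz i) (sz j) * ρ j u) - ρ i u) (Ici 0) u :=
    fun c i u hu => ((hphi i u hu).const_mul (c i)).sub (hd i u hu)
  constructor
  · rintro ⟨hρ, hlt, c, hc, hsum⟩
    have hc0 : ∀ i, 0 ≤ c i := fun i => by
      have h1 := hlt 0 self_mem_Ici
      have h2 := sum_min_sz_mul_le (fun j => hnn j 0 self_mem_Ici) i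
      exact nonneg_of_mul_nonneg_left ((hnn i 0 self_mem_Ici).trans (hc i 0 self_mem_Ici))
        (by linarith)
    set δ : ℝ := 1 - 2 * ∑ i, sz i * c i with hδ
    have hδ0 : 0 < δ := by linarith
    have hlow : ∀ u ∈ Ici (0 : ℝ), δ ≤ 1 - ∑ j, 2 * sz j * ρ j u := fun u hu => by
      have := sum_two_sz_mul_le (fun i => hnn i u hu) hc0 (fun i => hc i u hu)
      linarith
    have htop : ∀ u ∈ Ici (0 : ℝ), HasDerivWithinAt (phiTop ψ)
        (1 - ∑ j, 2 * sz j * ρ j u) (Ici 0) u := fun u hu =>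
      hasDerivWithinAt_sub_sum (fun j => hd j u hu) _
    have hm : MonotoneOn (fun u => phiTop ψ u - δ * u) (Ici 0) :=
      monotoneOn_Ici_of_hasDerivWithinAt
        (fun u hu => (htop u hu).sub ((hasDerivWithinAt_id u _).const_mul δ))
        (fun u hu => by have := hlow u hu; linarith)
    have hstrict : StrictMonoOn (phiTop ψ) (Ici 0) := fun u hu v hv huv => by
      have h1 : phiTop ψ u - δ * u ≤ phiTop ψ v - δ * v := hm hu hv huv.le
      have h2 := mul_lt_mul_of_pos_left huv hδ0
      linarith
    have htop0 : phiTop ψ 0 = 0 := by simp [phiTop, hψ0]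
    have hge : ∀ u ∈ Ici (0 : ℝ), δ * u ≤ phiTop ψ u := fun u hu => by
      have h1 : phiTop ψ 0 - δ * 0 ≤ phiTop ψ u - δ * u := hm self_mem_Ici hu hu
      linarith
    refine ⟨⟨⟨hC, ⟨fun u hu => (htop u hu).continuousWithinAt, hstrict.monotoneOn, htop0,
      fun u hu => (mul_nonneg hδ0.le hu).trans (hge u hu)⟩, hstrict, ?_⟩, c, ?_, hsum⟩,
      fun i => ⟨hC i, (hreg i).2 (hρ i).2⟩⟩
    · refine tendsto_atTop_mono' atTop ?_ (tendsto_id.const_mul_atTop hδ0)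
      filter_upwards [eventually_ge_atTop 0] with u hu using hge u hu
    · intro i u₁ h₁ u₂ h₂ h
      have h3 : c i * phi ψ i u₂ - ψ i u₂ ≤ c i * phi ψ i u₁ - ψ i u₁ :=
        monotoneOn_Ici_of_hasDerivWithinAt (hgap c i)
          (fun u hu => sub_nonneg.2 (hc i u hu)) h₂ h₁ h.le
      linarith
  · rintro ⟨⟨⟨-, -, hstrict, -⟩, c, hc, hsum⟩, hCq⟩
    have hc0 : ∀ i, 0 ≤ c i := fun i => by
      have h0 : (0 : ℝ) ∈ Ici (0 : ℝ) := self_mem_Ici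
      have h1 : (1 : ℝ) ∈ Ici (0 : ℝ) := mem_Ici.2 zero_le_one
      have ht := hstrict h0 h1 zero_lt_one
      have hle := sum_min_sz_mul_le (fun j => (hC j).2.2.2 1 h1) i
      have hp := hc i 1 h1 0 h0 zero_lt_one
      have hn := hmono i h0 h1 zero_le_one
      refine nonneg_of_mul_nonneg_left ((sub_nonneg.2 hn).trans hp) ?_
      simp only [phi, phiTop, hψ0, mul_zero, Finset.sum_const_zero] at ht ⊢
      linarith
    have hle : ∀ i, ∀ u ∈ Ici (0 : ℝ),
        ρ i u ≤ c i * (1 - ∑ j, 2 * min (sz i) (sz j) * ρ j u) := fun i u hu => by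
      have hm : MonotoneOn (fun v => c i * phi ψ i v - ψ i v) (Ici 0) := fun v hv w hw hvw => by
        rcases hvw.eq_or_lt with rfl | hvw
        · exact le_rfl
        · have := hc i w hw v hv hvw
          simp only
          linarith
      have h := hm.derivWithin_nonneg (x := u)
      rw [(hgap c i u hu).derivWithin (uniqueDiffOn_Ici 0 u hu)] at h
      exact sub_nonneg.1 h
    refine ⟨fun i => ⟨hnn i, (hreg i).1 (hCq i).2⟩, fun u hu => ?_, c, hle, hsum⟩
    have := sum_two_sz_mul_le (fun i => hnn i u hu) hc0 (fun i => hle i u hu)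
    linarith
end
end
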